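/- There exists a truth-preserving translation from RoCTL* into CTL*: a function RC from RoCTL* formulas to CTL* formulas such that for every RoCTL-structure M, every fullpath σ through M, and every RoCTL* formula φ: M,σ ⊨ φ if and only if M,σ ⊨ RC(φ). -/

import Mathlib

/-! STATEMENT 16: there is a truth-preserving translation RC from RoCTL* into CTL*. -/

namespace Stmt16
/-- A structure: a set of worlds `W`, a binary accessibility relation and a
valuation assigning to each world the set of atoms true there. -/
structure KStruct (V : Type) (W : Type) where
  rel : W → W → Prop
  val : W → Set V

variable {V W W' : Type}

/-- The accessibility relation is serial. -/
def KStruct.Serial (M : KStruct V W) : Prop := ∀ w, ∃ v, M.rel w v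

/-- `σ` is a fullpath through `M`. -/
def IsFullpath (M : KStruct V W) (σ : ℕ → W) : Prop := ∀ i, M.rel (σ i) (σ (i + 1))

/-- The suffix `σ≥n` of a fullpath. -/
def suffix (σ : ℕ → W) (n : ℕ) : ℕ → W := fun i => σ (i + n)

/-- A fullpath is failure-free iff the violation atom is false at all
positions `i > 0`. -/
def FailureFree (M : KStruct V W) (viol : V) (σ : ℕ → W) : Prop :=
  ∀ i, 0 < i → viol ∉ M.val (σ i)

/-- A RoCTL-structure: serial, and every world starts some failure-free fullpath. -/
def IsRoCTL (M : KStruct V W) (viol : V) : Prop :=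
  M.Serial ∧ ∀ w, ∃ σ, IsFullpath M σ ∧ σ 0 = w ∧ FailureFree M viol σ

/-- `π` is a deviation from `σ`: for some `i`, `π≤i = σ≤i` and `π≥(i+1)` is
failure-free. -/
def IsDeviation (M : KStruct V W) (viol : V) (σ π : ℕ → W) : Prop :=
  ∃ i, (∀ j ≤ i, π j = σ j) ∧ FailureFree M viol (suffix π (i + 1))

/-- RoCTL* formulas: atoms, ¬, ∧, U, N, A, O, ▲. -/
inductive Form (V : Type) : Type where
  | atom : V → Form V
  | neg : Form V → Form V
  | conj : Form V → Form V → Form V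
  | untl : Form V → Form V → Form V
  | next : Form V → Form V
  | fall : Form V → Form V
  | oblig : Form V → Form V
  | robust : Form V → Form V

/-- Truth of a RoCTL* formula on a fullpath. -/
def sat (M : KStruct V W) (viol : V) : Form V → (ℕ → W) → Prop
  | .atom p, σ => p ∈ M.val (σ 0)
  | .neg φ, σ => ¬ sat M viol φ σ
  | .conj φ ψ, σ => sat M viol φ σ ∧ sat M viol ψ σ
  | .untl φ ψ, σ => ∃ i, sat M viol ψ (suffix σ i) ∧ ∀ j < i, sat M viol φ (suffix σ j)
  | .next φ, σ => sat M viol φ (suffix σ 1)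
  | .fall φ, σ => ∀ π, IsFullpath M π → π 0 = σ 0 → sat M viol φ π
  | .oblig φ, σ => ∀ π, IsFullpath M π → π 0 = σ 0 → FailureFree M viol π → sat M viol φ π
  | .robust φ, σ => sat M viol φ σ ∧
      ∀ π, IsFullpath M π → IsDeviation M viol σ π → sat M viol φ π

/-- RoCTL* formulas have atoms ranging over `V \ {viol}`. -/
def ViolFree (viol : V) : Form V → Prop
  | .atom p => p ≠ viol
  | .neg φ => ViolFree viol φ
  | .conj φ ψ => ViolFree viol φ ∧ ViolFree viol ψ
  | .untl φ ψ => ViolFree viol φ ∧ ViolFree viol ψ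
  | .next φ => ViolFree viol φ
  | .fall φ => ViolFree viol φ
  | .oblig φ => ViolFree viol φ
  | .robust φ => ViolFree viol φ
/-- CTL* formulas: the fragment of RoCTL* without the O and ▲ operators. -/
def IsCTL : Form V → Prop
  | .atom _ => True
  | .neg φ => IsCTL φ
  | .conj φ ψ => IsCTL φ ∧ IsCTL ψ
  | .untl φ ψ => IsCTL φ ∧ IsCTL ψ
  | .next φ => IsCTL φ
  | .fall φ => IsCTL φ
  | .oblig _ => False
  | .robust _ => False

/-- Derived operators. -/
def ftop (viol : V) : Form V := .neg (.conj (.atom viol) (.neg (.atom viol)))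
def fF (viol : V) (a : Form V) : Form V := .untl (ftop viol) a
def fG (viol : V) (a : Form V) : Form V := .neg (fF viol (.neg a))
def fE (a : Form V) : Form V := .neg (.fall (.neg a))

/-- AGEN¬v. -/
def agenv (viol : V) : Form V := .fall (fG viol (fE (.next (.neg (.atom viol)))))

/-! ### Abstract closure theorem for counter-free automata -/

section Abstract

variable {X : Type*} {Q A : Type}

/-- A class of predicates closed under boolean operations. -/
structure BoolClosed (D : Set (X → Prop)) : Prop where
  top : (fun _ => True) ∈ D
  neg : ∀ P ∈ D, (fun x => ¬ P x) ∈ D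
  conj : ∀ P ∈ D, ∀ R ∈ D, (fun x => P x ∧ R x) ∈ D

theorem BoolClosed.congr' {D : Set (X → Prop)} {P R : X → Prop} (h : P ∈ D)
    (e : ∀ x, R x ↔ P x) : R ∈ D := by
  have : R = P := funext fun x => propext (e x)
  rw [this]; exact h

theorem BoolClosed.const {D : Set (X → Prop)} (hD : BoolClosed D) (p : Prop) :
    (fun _ => p) ∈ D := by
  by_cases h : p
  · exact congr' hD.top (by simp [h])
  · exact congr' (hD.neg _ hD.top) (by simp [h])

theorem BoolClosed.disj {D : Set (X → Prop)} (hD : BoolClosed D) {P R : X → Prop}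
    (hP : P ∈ D) (hR : R ∈ D) : (fun x => P x ∨ R x) ∈ D :=
  congr' (hD.neg _ (hD.conj _ (hD.neg _ hP) _ (hD.neg _ hR))) (by intro x; tauto)

theorem BoolClosed.ex {D : Set (X → Prop)} (hD : BoolClosed D) {ι : Type} [Finite ι]
    {P : ι → X → Prop} (hP : ∀ i, P i ∈ D) : (fun x => ∃ i, P i x) ∈ D := by
  classical
  cases nonempty_fintype ι
  have key : ∀ s : Finset ι, (fun x => ∃ i ∈ s, P i x) ∈ D := by
    intro s
    induction s using Finset.induction_on with
    | empty => exact congr' (hD.const False) (by simp)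
    | insert a s _ ih => exact congr' (hD.disj (hP a) ih) (by simp)
  exact congr' (key Finset.univ) (by simp)

theorem BoolClosed.all {D : Set (X → Prop)} (hD : BoolClosed D) {ι : Type} [Finite ι]
    {P : ι → X → Prop} (hP : ∀ i, P i ∈ D) : (fun x => ∀ i, P i x) ∈ D :=
  congr' (hD.neg _ (hD.ex (fun i => hD.neg _ (hP i)))) (by intro x; simp)

/-- Until along a labelled transition relation. -/
inductive Utl (T : X → A → X → Prop) (P R : X → Prop) : X → Prop
  | base {x} : R x → Utl T P R x
  | step {x a y} : P x → T x a y → Utl T P R y → Utl T P R x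

/-- `D` is closed under next and until along the deterministic relation `T`. -/
structure Closed (D : Set (X → Prop)) (T : X → A → X → Prop) : Prop where
  det : ∀ {x a y b z}, T x a y → T x b z → a = b ∧ y = z
  next : ∀ a, ∀ P ∈ D, (fun x => ∃ y, T x a y ∧ P y) ∈ D
  untl : ∀ P ∈ D, ∀ R ∈ D, Utl T P R ∈ D

/-- Labelled paths. -/
def LPath (T : X → A → X → Prop) : X → List A → X → Prop
  | x, [], y => x = y
  | x, a :: u, y => ∃ z, T x a z ∧ LPath T z u y

/-- Action of words on states. -/
def act (δ : A → Q → Q) : List A → Q → Q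
  | [], q => q
  | a :: u, q => act δ u (δ a q)

theorem act_append (δ : A → Q → Q) (u v : List A) (q : Q) :
    act δ (u ++ v) q = act δ v (act δ u q) := by
  induction u generalizing q with
  | nil => rfl
  | cons a u ih => exact ih _

/-- Counter-freeness. -/
def CFree (δ : A → Q → Q) : Prop :=
  ∀ u : List A, ∃ n, ∀ q, act δ u ((act δ u)^[n] q) = (act δ u)^[n] q

/-- Some path leads from state `q` to `q'` and ends in a point satisfying `β`. -/
inductive Cat (T : X → A → X → Prop) (δ : A → Q → Q) (q' : Q) (β : X → Prop) : Q → X → Prop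
  | halt {x} : β x → Cat T δ q' β q' x
  | step {q x a y} : T x a y → Cat T δ q' β (δ a q) y → Cat T δ q' β q x

theorem cat_iff (T : X → A → X → Prop) (δ : A → Q → Q) (q' : Q) (β : X → Prop) (q : Q) (x : X) :
    Cat T δ q' β q x ↔ ∃ u y, LPath T x u y ∧ act δ u q = q' ∧ β y := by
  constructor
  · intro h
    induction h with
    | halt h => exact ⟨[], _, rfl, rfl, h⟩
    | step h _ ih =>
      obtain ⟨u, y, h1, h2, h3⟩ := ih
      exact ⟨_ :: u, y, ⟨_, h, h1⟩, h2, h3⟩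
  · rintro ⟨u, y, h1, h2, h3⟩
    induction u generalizing q x with
    | nil => cases h1; cases h2; exact .halt h3
    | cons a u ih =>
      obtain ⟨z, hz, h1⟩ := h1
      exact .step hz (ih _ _ h1 h2)

/-- Prepending a path. -/
theorem cat_prepend {T : X → A → X → Prop} {δ : A → Q → Q} {q' : Q} {β : X → Prop} {q : Q}
    {x y : X} {u : List A} (h : LPath T x u y) (hc : Cat T δ q' β (act δ u q) y) :
    Cat T δ q' β q x := by
  induction u generalizing q x with
  | nil => cases h; exact hc
  | cons a u ih =>
    obtain ⟨z, hz, h1⟩ := h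
    exact .step hz (ih h1 hc)

/-- Restriction of the relation to the letters other than `a`. -/
def TB (T : X → A → X → Prop) (a : A) : X → {b // b ≠ a} → X → Prop := fun x b y => T x b.1 y

def dB (δ : A → Q → Q) (a : A) : {b // b ≠ a} → Q → Q := fun b => δ b.1

theorem act_dB (δ : A → Q → Q) (a : A) (u : List {b // b ≠ a}) (q : Q) :
    act (dB δ a) u q = act δ (u.map Subtype.val) q := by
  induction u generalizing q with
  | nil => rfl
  | cons b u ih => exact ih _

theorem lpath_TB {T : X → A → X → Prop} {a : A} {u : List {b // b ≠ a}} {x y : X}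
    (h : LPath (TB T a) x u y) : LPath T x (u.map Subtype.val) y := by
  induction u generalizing x with
  | nil => exact h
  | cons b u ih =>
    obtain ⟨z, hz, h1⟩ := h
    exact ⟨z, hz, ih h1⟩

/-- Block letters. -/
def Blk (δ : A → Q → Q) (a : A) : Type :=
  {f : Set.range (δ a) → Set.range (δ a) //
    ∃ u : List {b // b ≠ a}, ∀ q, (f q).1 = δ a (act (dB δ a) u q.1)}

/-- Block relation. -/
def TK (T : X → A → X → Prop) (δ : A → Q → Q) (a : A) : X → Blk δ a → X → Prop :=
  fun x f y => ∃ u z, LPath (TB T a) x u z ∧ T z a y ∧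
    ∀ q, (f.1 q).1 = δ a (act (dB δ a) u q.1)

def dK (δ : A → Q → Q) (a : A) : Blk δ a → Set.range (δ a) → Set.range (δ a) := fun f => f.1

theorem closed_TB [Finite A] {D : Set (X → Prop)} (hD : BoolClosed D) {T : X → A → X → Prop}
    (hT : Closed D T) (a : A) : Closed D (TB T a) where
  det h1 h2 := ⟨Subtype.ext (hT.det h1 h2).1, (hT.det h1 h2).2⟩
  next b P hP := hT.next b.1 P hP
  untl P hP R hR := by
    have hb : (fun x => ∃ b : {b // b ≠ a}, ∃ y, T x b.1 y ∧ True) ∈ D :=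
      hD.ex fun b => hT.next b.1 _ hD.top
    refine BoolClosed.congr' (hT.untl _ (hD.conj _ hP _ hb) R hR) ?_
    intro x
    constructor
    · intro h
      induction h with
      | base h => exact .base h
      | step h1 h2 _ ih => exact .step ⟨h1, _, _, h2, trivial⟩ h2 ih
    · intro h
      induction h with
      | base h => exact .base h
      | @step x c y h1 h2 _ ih =>
        obtain ⟨h1, b, z, hz, -⟩ := h1
        obtain ⟨rfl, rfl⟩ := hT.det hz h2
        exact .step (a := b) h1 hz ih

theorem blk_det {D : Set (X → Prop)} {T : X → A → X → Prop} (hT : Closed D T) {a : A}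
    {u u' : List {b // b ≠ a}} {x z z' y y' : X}
    (h1 : LPath (TB T a) x u z) (h2 : T z a y) (h1' : LPath (TB T a) x u' z') (h2' : T z' a y') :
    u = u' ∧ y = y' := by
  induction u generalizing x u' with
  | nil =>
    cases h1
    cases u' with
    | nil => cases h1'; exact ⟨rfl, (hT.det h2 h2').2⟩
    | cons b u' =>
      obtain ⟨w, hw, -⟩ := h1'
      exact absurd (hT.det h2 hw).1.symm b.2
  | cons c u ih =>
    obtain ⟨w, hw, h1⟩ := h1
    cases u' with
    | nil => cases h1'; exact absurd (hT.det h2' hw).1.symm c.2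
    | cons b u' =>
      obtain ⟨w', hw', h1'⟩ := h1'
      obtain ⟨e1, rfl⟩ := hT.det hw hw'
      obtain ⟨rfl, e2⟩ := ih h1 h1'
      exact ⟨by rw [Subtype.ext e1], e2⟩

theorem utl_prepend {T : X → A → X → Prop} {a : A} {P R : X → Prop}
    (hP : ∀ x (b : {b // b ≠ a}) y, T x b.1 y → P x)
    {u : List {b // b ≠ a}} {x z : X} (h : LPath (TB T a) x u z) (hz : Utl T P R z) :
    Utl T P R x := by
  induction u generalizing x with
  | nil => cases h; exact hz
  | cons b u ih =>
    obtain ⟨w, hw, h⟩ := h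
    exact .step (hP _ _ _ hw) hw (ih h)

theorem closed_TK [Finite A] [Finite Q] [Nonempty Q] {D : Set (X → Prop)} (hD : BoolClosed D)
    {T : X → A → X → Prop} (hT : Closed D T) (δ : A → Q → Q) (a : A)
    (hB : ∀ q q' β, β ∈ D → Cat (TB T a) (dB δ a) q' β q ∈ D) : Closed D (TK T δ a) where
  det := by
    rintro x f y g z ⟨u, w, h1, h2, h3⟩ ⟨u', w', h1', h2', h3'⟩
    obtain ⟨rfl, rfl⟩ := blk_det hT h1 h2 h1' h2'
    refine ⟨Subtype.ext (funext fun q => Subtype.ext ?_), rfl⟩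
    rw [h3, h3']
  next f P hP := by
    have hm : (fun x => ∀ q : Set.range (δ a), ∃ q1 : {q1 // δ a q1 = (f.1 q).1},
        Cat (TB T a) (dB δ a) q1.1 (fun z => ∃ y, T z a y ∧ P y) q.1 x) ∈ D :=
      hD.all fun q => hD.ex fun q1 => hB _ _ _ (hT.next a P hP)
    refine BoolClosed.congr' hm ?_
    intro x
    constructor
    · rintro ⟨y, ⟨u, z, h1, h2, h3⟩, hy⟩ q
      exact ⟨⟨act (dB δ a) u q.1, (h3 q).symm⟩, (cat_iff ..).2 ⟨u, z, h1, rfl, y, h2, hy⟩⟩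
    · intro h
      obtain ⟨q0⟩ := ‹Nonempty Q›
      obtain ⟨q1, hq⟩ := h ⟨δ a q0, q0, rfl⟩
      obtain ⟨u, z, h1, -, y, h2, hy⟩ := (cat_iff ..).1 hq
      refine ⟨y, ⟨u, z, h1, h2, ?_⟩, hy⟩
      intro q
      obtain ⟨⟨q1', e⟩, hq'⟩ := h q
      obtain ⟨u', z', h1', h3', y', h2', hy'⟩ := (cat_iff ..).1 hq'
      obtain ⟨rfl, rfl⟩ := blk_det hT h1 h2 h1' h2'
      rw [h3', e]
  untl P hP R hR := by
    have hb : (fun x => ∃ b : {b // b ≠ a}, ∃ y, T x b.1 y ∧ True) ∈ D :=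
      hD.ex fun b => hT.next b.1 _ hD.top
    refine BoolClosed.congr' (hD.disj hR (hD.conj _ hP _
      (hT.untl _ (hD.disj hb (hT.next a P hP)) _ (hT.next a R hR)))) ?_
    intro x
    constructor
    · intro h
      induction h with
      | base h => exact .inl h
      | @step x f y hx hT' _ ih =>
        obtain ⟨u, z, h1, h2, -⟩ := hT'
        refine .inr ⟨hx, utl_prepend (fun x b y h => .inl ⟨b, y, h, trivial⟩) h1 ?_⟩
        rcases ih with hy | ⟨hy, hu⟩
        · exact .base ⟨y, h2, hy⟩
        · exact .step (.inr ⟨y, h2, hy⟩) h2 hu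
    · have key : ∀ x, Utl T (fun x => (∃ b : {b // b ≠ a}, ∃ y, T x b.1 y ∧ True) ∨
          ∃ y, T x a y ∧ P y) (fun x => ∃ y, T x a y ∧ R y) x →
          ∃ f y, TK T δ a x f y ∧ Utl (TK T δ a) P R y := by
        intro x h
        suffices ∃ u z y, LPath (TB T a) x u z ∧ T z a y ∧ Utl (TK T δ a) P R y by
          obtain ⟨u, z, y, h1, h2, h3⟩ := this
          exact ⟨⟨fun q => ⟨δ a (act (dB δ a) u q.1), _, rfl⟩, u, fun q => rfl⟩, y,
            ⟨u, z, h1, h2, fun q => rfl⟩, h3⟩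
        induction h with
        | base h =>
          obtain ⟨y, h1, h2⟩ := h
          exact ⟨[], _, y, rfl, h1, .base h2⟩
        | @step x c y' hx hT' _ ih =>
          obtain ⟨u, z, y, h1, h2, h3⟩ := ih
          by_cases hc : c = a
          · subst hc
            have hPy : P y' := by
              rcases hx with ⟨b, w, hw, -⟩ | ⟨w, hw, hP⟩
              · exact absurd (hT.det hw hT').1 b.2
              · rw [← (hT.det hw hT').2]; exact hP
            refine ⟨[], x, y', rfl, hT', ?_⟩
            exact .step (a := ⟨fun q => ⟨δ c (act (dB δ c) u q.1), _, rfl⟩, u, fun q => rfl⟩) hPy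
              ⟨u, z, h1, h2, fun q => rfl⟩ h3
          · exact ⟨⟨c, hc⟩ :: u, z, y, ⟨y', hT', h1⟩, h2, h3⟩
      rintro (h | ⟨h, hu⟩)
      · exact .base h
      · obtain ⟨f, y, h1, h2⟩ := key x hu
        exact .step h h1 h2

theorem cfree_dB {δ : A → Q → Q} (h : CFree δ) (a : A) : CFree (dB δ a) := by
  intro u
  have e : act (dB δ a) u = act δ (u.map Subtype.val) := funext (act_dB δ a u)
  rw [e]
  exact h _

theorem cfree_dK {δ : A → Q → Q} (h : CFree δ) (a : A) : CFree (dK δ a) := by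
  intro w
  have : ∃ v : List A, ∀ q : Set.range (δ a), (act (dK δ a) w q).1 = act δ v q.1 := by
    induction w with
    | nil => exact ⟨[], fun q => rfl⟩
    | cons f w ih =>
      obtain ⟨v, hv⟩ := ih
      obtain ⟨u, hu⟩ := f.2
      refine ⟨u.map Subtype.val ++ a :: v, fun q => ?_⟩
      rw [act_append, ← act_dB]
      change (act (dK δ a) w (f.1 q)).1 = act δ v (δ a _)
      rw [hv, hu]
  obtain ⟨v, hv⟩ := this
  obtain ⟨n, hn⟩ := h v
  have it : ∀ (n : ℕ) (q : Set.range (δ a)),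
      ((act (dK δ a) w)^[n] q).1 = (act δ v)^[n] q.1 := by
    intro n
    induction n with
    | zero => intro q; rfl
    | succ n ih => intro q; rw [Function.iterate_succ_apply', Function.iterate_succ_apply', hv, ih]
  refine ⟨n, fun q => Subtype.ext ?_⟩
  rw [hv, it, hn]

/-- Counter-free prefixes may be concatenated with definable suffixes. -/
theorem cat_mem {D : Set (X → Prop)} (hD : BoolClosed D) (n m : ℕ) :
    ∀ (Q A : Type) [Finite Q] [Finite A], Nat.card Q = n → Nat.card A = m →
      ∀ (T : X → A → X → Prop), Closed D T → ∀ (δ : A → Q → Q), CFree δ →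
      ∀ q q' β, β ∈ D → Cat T δ q' β q ∈ D := by
  induction n using Nat.strong_induction_on generalizing m with
  | _ n ihn =>
  induction m using Nat.strong_induction_on with
  | _ m ihm =>
  intro Q A _ _ hQ hA T hT δ hδ q q' β hβ
  by_cases hinj : ∀ a, Function.Injective (δ a)
  · have hid : ∀ a q, δ a q = q := by
      intro a q
      obtain ⟨n, hn⟩ := hδ [a]
      have h1 := hn q
      have h2 := (Function.iterate_succ_apply' (act δ [a]) n q).trans h1
      rw [Function.iterate_succ_apply] at h2
      replace h1 := h2
      exact (Function.Injective.iterate (hinj a) n) h1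
    refine BoolClosed.congr' (hD.conj _ (hD.const (q = q')) _ (hT.untl _ hD.top β hβ)) ?_
    intro x
    constructor
    · intro h
      induction h with
      | halt h => exact ⟨rfl, .base h⟩
      | step h1 _ ih => exact ⟨(hid _ _).symm.trans ih.1, .step trivial h1 ih.2⟩
    · rintro ⟨rfl, h⟩
      induction h with
      | base h => exact .halt h
      | step _ h1 _ ih => refine .step h1 ?_; rw [hid]; exact ih
  · push Not at hinj
    obtain ⟨a, ha⟩ := hinj
    have hcardQ : Nat.card (Set.range (δ a)) < n := by
      rw [← hQ]
      refine lt_of_le_of_ne (Finite.card_subtype_le _) fun e => ?_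
      have hs : Set.range (δ a) = Set.univ :=
        Set.eq_of_subset_of_ncard_le (Set.subset_univ _)
          (by rw [Set.ncard_univ]; exact e.ge)
      exact ha (Finite.injective_iff_surjective.2 (Set.range_eq_univ.1 hs))
    have hcardB : Nat.card {b // b ≠ a} < m := by
      rw [← hA]
      exact Finite.card_subtype_lt (x := a) (by simp)
    have hB : ∀ q q' β, β ∈ D → Cat (TB T a) (dB δ a) q' β q ∈ D :=
      ihm _ hcardB Q _ hQ rfl _ (closed_TB hD hT a) _ (cfree_dB hδ a)
    have : Nonempty Q := ⟨q⟩
    have : Finite (Blk δ a) := by unfold Blk; infer_instance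
    have hK : ∀ q q' β, β ∈ D → Cat (TK T δ a) (dK δ a) q' β q ∈ D :=
      ihn _ hcardQ _ _ _ rfl rfl _ (closed_TK hD hT δ a hB) _ (cfree_dK hδ a)
    have hrest : ∀ q1 : Q, (fun y => ∃ q3 : Set.range (δ a), Cat (TK T δ a) (dK δ a) q3
        (Cat (TB T a) (dB δ a) q' β q3.1) ⟨δ a q1, q1, rfl⟩ y) ∈ D :=
      fun q1 => hD.ex fun q3 => hK _ _ _ (hB _ _ _ hβ)
    refine BoolClosed.congr' (hD.disj (hB q q' β hβ) (hD.ex fun q1 : Q =>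
      hB q q1 _ (hT.next a _ (hrest q1)))) ?_
    intro x
    constructor
    · intro h
      induction h with
      | halt h => exact .inl (.halt h)
      | @step q x b y h1 _ ih =>
        by_cases hb : b = a
        · subst hb
          refine .inr ⟨q, .halt ⟨y, h1, ?_⟩⟩
          rcases ih with h | ⟨q1, h⟩
          · exact ⟨⟨δ b q, q, rfl⟩, .halt h⟩
          · obtain ⟨u, z, h2, h3, y', h4, q3, h5⟩ := (cat_iff ..).1 h
            refine ⟨q3, .step (a := ⟨fun q => ⟨δ b (act (dB δ b) u q.1), _, rfl⟩, u,
              fun q => rfl⟩) ⟨u, z, h2, h4, fun q => rfl⟩ ?_⟩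
            subst h3
            exact h5
        · rcases ih with h | ⟨q1, h⟩
          · exact .inl (.step (a := ⟨b, hb⟩) h1 h)
          · exact .inr ⟨q1, .step (a := ⟨b, hb⟩) h1 h⟩
    · have hBT : ∀ q y, Cat (TB T a) (dB δ a) q' β q y → Cat T δ q' β q y := by
        intro q y h
        induction h with
        | halt h => exact .halt h
        | step h1 _ ih => exact .step h1 ih
      rintro (h | ⟨q1, h⟩)
      · exact hBT _ _ h
      · obtain ⟨u, z, h2, h3, y, h4, q3, h5⟩ := (cat_iff ..).1 h
        refine cat_prepend (lpath_TB h2) ?_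
        rw [← act_dB, h3]
        refine .step h4 ?_
        have key : ∀ (p : Set.range (δ a)) y, Cat (TK T δ a) (dK δ a) q3
            (Cat (TB T a) (dB δ a) q' β q3.1) p y → Cat T δ q' β p.1 y := by
          intro p y h
          induction h with
          | halt h => exact hBT _ _ h
          | @step p x f y h1 _ ih =>
            obtain ⟨u, z, h6, h7, h8⟩ := h1
            refine cat_prepend (lpath_TB h6) (.step h7 ?_)
            rw [← act_dB, ← h8]
            exact ih
        exact key _ _ h5

end Abstract

/-! ### Paths of structures -/

/-- A fullpath in a structure. -/
structure Pt (V : Type) : Type 1 where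
  W : Type
  M : KStruct V W
  σ : ℕ → W
  full : IsFullpath M σ

theorem full_suffix {M : KStruct V W} {σ : ℕ → W} (h : IsFullpath M σ) (n : ℕ) :
    IsFullpath M (suffix σ n) := by
  intro i
  have := h (i + n)
  simpa [suffix, Nat.add_right_comm] using this

/-- The tail of a path. -/
def Pt.tail (x : Pt V) : Pt V := ⟨x.W, x.M, suffix x.σ 1, full_suffix x.full 1⟩

/-- Predicates on paths definable in CTL*. -/
def Dfn (viol : V) : Set (Pt V → Prop) :=
  {P | ∃ φ : Form V, IsCTL φ ∧ ∀ x, P x ↔ sat x.M viol φ x.σ}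

theorem dfn_sat (viol : V) {φ : Form V} (h : IsCTL φ) :
    (fun x : Pt V => sat x.M viol φ x.σ) ∈ Dfn viol := ⟨φ, h, fun _ => Iff.rfl⟩

theorem dfn_bool (viol : V) : BoolClosed (Dfn viol) where
  top := ⟨ftop viol, by simp [ftop, IsCTL], fun x => by simp [ftop, sat]⟩
  neg := by
    rintro P ⟨φ, h, hP⟩
    exact ⟨.neg φ, h, fun x => not_congr (hP x)⟩
  conj := by
    rintro P ⟨φ, h, hP⟩ R ⟨ψ, h', hR⟩
    exact ⟨.conj φ ψ, ⟨h, h'⟩, fun x => and_congr (hP x) (hR x)⟩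

theorem dfn_next {viol : V} {P : Pt V → Prop} (h : P ∈ Dfn viol) :
    (fun x => P x.tail) ∈ Dfn viol := by
  obtain ⟨φ, h, hP⟩ := h
  exact ⟨.next φ, h, fun x => hP x.tail⟩

/-- Existential path quantification. -/
theorem dfn_ex {viol : V} {P : Pt V → Prop} (h : P ∈ Dfn viol) :
    (fun x => ∃ π, ∃ h : IsFullpath x.M π, π 0 = x.σ 0 ∧ P ⟨x.W, x.M, π, h⟩) ∈ Dfn viol := by
  obtain ⟨φ, h, hP⟩ := h
  refine ⟨fE φ, h, fun x => ?_⟩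
  simp only [fE, sat, hP]
  push Not
  constructor
  · rintro ⟨π, a, b, c⟩; exact ⟨π, a, b, c⟩
  · rintro ⟨π, a, b, c⟩; exact ⟨π, a, b, c⟩

theorem dfn_ff (viol : V) : (fun x : Pt V => FailureFree x.M viol x.σ) ∈ Dfn viol := by
  refine ⟨.next (fG viol (.neg (.atom viol))), by simp [fG, fF, ftop, IsCTL], fun x => ?_⟩
  simp only [FailureFree, fG, fF, ftop, sat, suffix]
  constructor
  · rintro h ⟨i, h1, -⟩
    exact h1 (h _ (by omega))
  · intro h i hi hv
    refine h ⟨i - 1, ?_, by simp⟩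
    have e : 0 + (i - 1) + 1 = i := by omega
    rw [e]
    exact fun h => h hv

/-- The step relation given by a labelling. -/
def TL {A : Type} (lab : Pt V → A) : Pt V → A → Pt V → Prop := fun x a y => lab x = a ∧ y = x.tail

theorem closed_TL {A : Type} {viol : V} {lab : Pt V → A}
    (hl : ∀ a, (fun x => lab x = a) ∈ Dfn viol) : Closed (Dfn viol) (TL lab) where
  det := by
    rintro x a y b z ⟨rfl, rfl⟩ ⟨rfl, rfl⟩
    exact ⟨rfl, rfl⟩
  next a P hP := BoolClosed.congr' ((dfn_bool viol).conj _ (hl a) _ (dfn_next hP)) (by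
    intro x; simp [TL])
  untl P hP R hR := by
    obtain ⟨φ, h, hP⟩ := hP
    obtain ⟨ψ, h', hR⟩ := hR
    refine ⟨.untl φ ψ, ⟨h, h'⟩, fun x => ?_⟩
    constructor
    · intro h
      induction h with
      | base h => exact ⟨0, (hR _).1 h, by simp⟩
      | step h1 h2 _ ih =>
        obtain ⟨-, rfl⟩ := h2
        obtain ⟨i, h3, h4⟩ := ih
        refine ⟨i + 1, h3, ?_⟩
        intro j hj
        cases j with
        | zero => exact (hP _).1 h1
        | succ j => exact h4 j (by omega)
    · rintro ⟨i, h1, h2⟩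
      induction i generalizing x with
      | zero => exact .base ((hR x).2 h1)
      | succ i ih =>
        refine .step ((hP x).2 (h2 0 (by omega))) ⟨rfl, rfl⟩ (ih x.tail h1 ?_)
        intro j hj
        exact h2 (j + 1) (by omega)

/-- Backward action of words. -/
def bact {Q A : Type} (f : A → Q → Q) : List A → Q → Q
  | [], t => t
  | a :: u, t => f a (bact f u t)

/-- A finite counter-free backward deterministic typing of paths. -/
structure Sys (viol : V) where
  Q : Type
  A : Type
  finQ : Finite Q
  finA : Finite A
  ty : Pt V → Q
  lab : Pt V → A
  f : A → Q → Q
  ty_eq : ∀ x, ty x = f (lab x) (ty x.tail)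
  ty_dfn : ∀ t, (fun x => ty x = t) ∈ Dfn viol
  lab_dfn : ∀ a, (fun x => lab x = a) ∈ Dfn viol
  lab_loc : ∀ (W : Type) (M : KStruct V W) σ π hσ hπ, σ 0 = π 0 →
    lab ⟨W, M, σ, hσ⟩ = lab ⟨W, M, π, hπ⟩
  cf : ∀ u : List A, ∃ n, ∀ t, bact f u ((bact f u)^[n] t) = (bact f u)^[n] t

/-- Predicates decided by the type. -/
def Sys.Dec {viol : V} (S : Sys viol) : Set (Pt V → Prop) := {P | ∃ F : Set S.Q, ∀ x, P x ↔ S.ty x ∈ F}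

theorem dfn_eq {viol : V} {P : Pt V → Prop} (h : P ∈ Dfn viol) (p : Prop) :
    (fun x => P x = p) ∈ Dfn viol := by
  by_cases hp : p
  · exact BoolClosed.congr' h (by simp [hp])
  · exact BoolClosed.congr' ((dfn_bool viol).neg _ h) (by simp [hp])

/-- Extension by a flip-flop. -/
theorem Sys.extend {viol : V} (S : Sys viol) (e P : Pt V → Prop) (he : e ∈ Dfn viol)
    (hP : P ∈ Dfn viol)
    (hloc : ∀ (W : Type) (M : KStruct V W) σ π hσ hπ, σ 0 = π 0 →
      e ⟨W, M, σ, hσ⟩ = e ⟨W, M, π, hπ⟩)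
    (s k : S.A × Prop → S.Q → Prop)
    (hsk : ∀ x, P x ↔ s (S.lab x, e x) (S.ty x.tail) ∨
      (k (S.lab x, e x) (S.ty x.tail) ∧ P x.tail)) :
    ∃ S' : Sys viol, S.Dec ⊆ S'.Dec ∧ P ∈ S'.Dec := by
  have := S.finA
  have := S.finQ
  let f' : S.A × Prop → S.Q × Prop → S.Q × Prop :=
    fun a t => (S.f a.1 t.1, s a t.1 ∨ (k a t.1 ∧ t.2))
  have hcf : ∀ u : List (S.A × Prop), ∃ n, ∀ t,
      bact f' u ((bact f' u)^[n] t) = (bact f' u)^[n] t := by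
    intro u
    have h1 : ∀ t, (bact f' u t).1 = bact S.f (u.map Prod.fst) t.1 := by
      intro t
      induction u with
      | nil => rfl
      | cons a u ih => simp only [bact, List.map_cons, f', ih]
    have h2 : ∃ s' k' : S.Q → Prop, ∀ t, (bact f' u t).2 ↔ (s' t.1 ∨ (k' t.1 ∧ t.2)) := by
      clear h1
      induction u with
      | nil => exact ⟨fun _ => False, fun _ => True, fun t => by simp [bact]⟩
      | cons a u ih =>
        have h1 : ∀ t, (bact f' u t).1 = bact S.f (u.map Prod.fst) t.1 := by
          intro t
          clear ih
          induction u with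
          | nil => rfl
          | cons a u ih => simp only [bact, List.map_cons, f', ih]
        obtain ⟨s', k', h⟩ := ih
        refine ⟨fun t => s a (bact S.f (u.map Prod.fst) t) ∨
          (k a (bact S.f (u.map Prod.fst) t) ∧ s' t),
          fun t => k a (bact S.f (u.map Prod.fst) t) ∧ k' t, fun t => ?_⟩
        change (s a (bact f' u t).1 ∨ (k a (bact f' u t).1 ∧ (bact f' u t).2)) ↔ _
        rw [h, h1]
        tauto
    obtain ⟨s', k', h2⟩ := h2
    obtain ⟨n, hn⟩ := S.cf (u.map Prod.fst)
    have it : ∀ (n : ℕ) t, ((bact f' u)^[n] t).1 = (bact S.f (u.map Prod.fst))^[n] t.1 := by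
      intro n
      induction n with
      | zero => intro t; rfl
      | succ n ih =>
        intro t
        rw [Function.iterate_succ_apply', Function.iterate_succ_apply', h1, ih]
    refine ⟨n + 1, fun t => ?_⟩
    rw [Function.iterate_succ_apply']
    have hfix : (bact f' u ((bact f' u)^[n] t)).1 = ((bact f' u)^[n] t).1 := by
      rw [h1, it, hn]
    refine Prod.ext ?_ (propext ?_)
    · rw [h1, hfix, ← h1]; exact hfix
    · rw [h2, h2, hfix]
      tauto
  refine ⟨{ Q := S.Q × Prop, A := S.A × Prop, finQ := inferInstance, finA := inferInstance,
            ty := fun x => (S.ty x, P x), lab := fun x => (S.lab x, e x), f := f',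
            ty_eq := ?_, ty_dfn := ?_, lab_dfn := ?_, lab_loc := ?_, cf := hcf }, ?_, ?_⟩
  · intro x
    exact Prod.ext (S.ty_eq x) (propext (hsk x))
  · rintro ⟨t, p⟩
    exact BoolClosed.congr' ((dfn_bool viol).conj _ (S.ty_dfn t) _ (dfn_eq hP p)) (by simp)
  · rintro ⟨t, p⟩
    exact BoolClosed.congr' ((dfn_bool viol).conj _ (S.lab_dfn t) _ (dfn_eq he p)) (by simp)
  · intro W M σ π hσ hπ h
    exact Prod.ext (S.lab_loc W M σ π hσ hπ h) (hloc W M σ π hσ hπ h)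
  · rintro R ⟨F, hF⟩
    exact ⟨{t | t.1 ∈ F}, hF⟩
  · exact ⟨{t | t.2}, fun x => Iff.rfl⟩

/-- The trivial system. -/
def Sys.triv (viol : V) : Sys viol where
  Q := Unit
  A := Unit
  finQ := inferInstance
  finA := inferInstance
  ty _ := ()
  lab _ := ()
  f _ _ := ()
  ty_eq _ := rfl
  ty_dfn _ := BoolClosed.congr' (dfn_bool viol).top (by simp)
  lab_dfn _ := BoolClosed.congr' (dfn_bool viol).top (by simp)
  lab_loc _ _ _ _ _ _ _ := rfl
  cf _ := ⟨0, fun _ => rfl⟩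

theorem exists_sys {viol : V} (φ : Form V) (h : IsCTL φ) (S : Sys viol) :
    ∃ S' : Sys viol, S.Dec ⊆ S'.Dec ∧ (fun x : Pt V => sat x.M viol φ x.σ) ∈ S'.Dec := by
  have hloc : ∀ (S : Sys viol) (ψ : Form V), IsCTL ψ →
      (∀ (W : Type) (M : KStruct V W) σ π, σ 0 = π 0 → sat M viol ψ σ = sat M viol ψ π) →
      ∃ S' : Sys viol, S.Dec ⊆ S'.Dec ∧ (fun x : Pt V => sat x.M viol ψ x.σ) ∈ S'.Dec := by
    intro S ψ hψ hl
    exact S.extend _ _ (dfn_sat viol hψ) (dfn_sat viol hψ)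
      (fun W M σ π _ _ h => hl W M σ π h) (fun a _ => a.2) (fun _ _ => False) (by simp)
  induction φ generalizing S with
  | atom p => exact hloc S _ h (fun W M σ π h => by simp only [sat, h])
  | neg φ ih =>
    obtain ⟨S', h1, F, hF⟩ := ih h S
    exact ⟨S', h1, Fᶜ, fun x => not_congr (hF x)⟩
  | conj φ ψ ih1 ih2 =>
    obtain ⟨S1, h1, h2⟩ := ih1 h.1 S
    obtain ⟨S2, h3, F, hF⟩ := ih2 h.2 S1
    obtain ⟨F', hF'⟩ := h3 h2
    exact ⟨S2, h1.trans h3, F' ∩ F, fun x => and_congr (hF' x) (hF x)⟩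
  | untl φ ψ ih1 ih2 =>
    obtain ⟨S1, h1, h2⟩ := ih1 h.1 S
    obtain ⟨S2, h3, F, hF⟩ := ih2 h.2 S1
    obtain ⟨F', hF'⟩ := h3 h2
    obtain ⟨S3, h4, h5⟩ := S2.extend (fun _ => True) _ (dfn_bool viol).top
      (dfn_sat viol (φ := .untl φ ψ) h) (fun _ _ _ _ _ _ _ => rfl)
      (fun a t => S2.f a.1 t ∈ F) (fun a t => S2.f a.1 t ∈ F') (by
        intro x
        simp only [← S2.ty_eq, ← hF, ← hF']
        constructor
        · rintro ⟨i, hi, hj⟩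
          cases i with
          | zero => exact .inl hi
          | succ i => exact .inr ⟨hj 0 (by omega), i, hi, fun j hj' => hj (j + 1) (by omega)⟩
        · rintro (hi | ⟨h0, i, hi, hj⟩)
          · exact ⟨0, hi, by simp⟩
          · refine ⟨i + 1, hi, fun j hj' => ?_⟩
            cases j with
            | zero => exact h0
            | succ j => exact hj j (by omega))
    exact ⟨S3, (h1.trans h3).trans h4, h5⟩
  | next φ ih =>
    obtain ⟨S1, h1, F, hF⟩ := ih h S
    obtain ⟨S2, h4, h5⟩ := S1.extend (fun _ => True) _ (dfn_bool viol).top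
      (dfn_sat viol (φ := .next φ) h) (fun _ _ _ _ _ _ _ => rfl)
      (fun _ t => t ∈ F) (fun _ _ => False) (by
        intro x
        simp only [← hF, false_and, or_false]
        rfl)
    exact ⟨S2, h1.trans h4, h5⟩
  | fall φ ih => exact hloc S _ h (fun W M σ π h => by simp only [sat, h])
  | oblig φ => exact h.elim
  | robust φ => exact h.elim

/-- A failure-free continuation after a deviation. -/
def Dev (viol : V) (P : Pt V → Prop) (x : Pt V) : Prop :=
  ∃ i π, ∃ h : IsFullpath x.M π, (∀ j ≤ i, π j = x.σ j) ∧
    FailureFree x.M viol (suffix π (i + 1)) ∧ P ⟨x.W, x.M, π, h⟩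

theorem act_pre {Q A : Type} (f : A → Q → Q) (u : List A) (F : Set Q) :
    act (fun a (F : Set Q) => {t | f a t ∈ F}) u F = {t | bact f u t ∈ F} := by
  induction u generalizing F with
  | nil => rfl
  | cons a u ih => exact ih _

theorem dev_dfn {viol : V} (S : Sys viol) (P : Pt V → Prop) (hP : P ∈ S.Dec) :
    Dev viol P ∈ Dfn viol := by
  have := S.finA
  have := S.finQ
  obtain ⟨F, hF⟩ := hP
  let δ : S.A → Set S.Q → Set S.Q := fun a F => {t | S.f a t ∈ F}
  have hcf : CFree δ := by
    intro u
    obtain ⟨n, hn⟩ := S.cf u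
    have it : ∀ (n : ℕ) F, (act δ u)^[n] F = {t | (bact S.f u)^[n] t ∈ F} := by
      intro n
      induction n with
      | zero => intro F; rfl
      | succ n ih =>
        intro F
        rw [Function.iterate_succ_apply, ih, act_pre]
        ext t
        simp only [Set.mem_ofPred_eq, Function.iterate_succ_apply']
    refine ⟨n, fun F => ?_⟩
    refine (Function.iterate_succ_apply' (act δ u) n F).symm.trans ?_
    rw [it, it]
    ext t
    simp only [Set.mem_ofPred_eq, Function.iterate_succ_apply', hn]
  let β : S.Q → Pt V → Prop := fun t x => ∃ π, ∃ h : IsFullpath x.M π, π 0 = x.σ 0 ∧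
    (FailureFree x.M viol (suffix π 1) ∧ S.ty ⟨x.W, x.M, π, h⟩ = t)
  have hβ : ∀ t, β t ∈ Dfn viol := fun t =>
    dfn_ex (P := fun x => FailureFree x.M viol (suffix x.σ 1) ∧ S.ty x = t)
      ((dfn_bool viol).conj _ (dfn_next (dfn_ff viol)) _ (S.ty_dfn t))
  have hC : ∀ t G, Cat (TL S.lab) δ G (β t) F ∈ Dfn viol := fun t G =>
    cat_mem (dfn_bool viol) _ _ _ _ rfl rfl _ (closed_TL S.lab_dfn) δ hcf _ _ _ (hβ t)
  have hU : (fun x => ∃ t, ∃ G : {G : Set S.Q // t ∈ G},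
      Cat (TL S.lab) δ G.1 (β t) F x) ∈ Dfn viol :=
    (dfn_bool viol).ex fun t => (dfn_bool viol).ex fun G => hC t G.1
  refine BoolClosed.congr' hU ?_
  intro x
  constructor
  · rintro ⟨i, π, h, h1, h2, h3⟩
    rw [hF] at h3
    clear hF hC hU
    induction i generalizing x π F with
    | zero =>
      exact ⟨_, ⟨F, h3⟩, .halt ⟨π, h, h1 0 le_rfl, h2, rfl⟩⟩
    | succ i ih =>
      have hl : S.lab ⟨x.W, x.M, π, h⟩ = S.lab x :=
        S.lab_loc _ _ _ _ _ x.full (h1 0 (by omega))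
      rw [S.ty_eq, hl] at h3
      obtain ⟨t, G, hG⟩ := ih (δ (S.lab x) F) x.tail (suffix π 1) (full_suffix h 1)
        (fun j hj => h1 (j + 1) (by omega)) h2 h3
      exact ⟨t, G, .step ⟨rfl, rfl⟩ hG⟩
  · rintro ⟨t, ⟨G, hG⟩, hc⟩
    have key : ∃ i π, ∃ h : IsFullpath x.M π, (∀ j ≤ i, π j = x.σ j) ∧
        FailureFree x.M viol (suffix π (i + 1)) ∧ S.ty ⟨x.W, x.M, π, h⟩ ∈ F := by
      clear hF hC hU
      induction hc with
      | halt h =>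
        obtain ⟨π, h, h1, h2, h3⟩ := h
        refine ⟨0, π, h, ?_, h2, ?_⟩
        · intro j hj
          obtain rfl : j = 0 := by omega
          exact h1
        · rw [h3]; exact hG
      | @step F x a y h _ ih =>
        obtain ⟨rfl, rfl⟩ := h
        obtain ⟨i, π, h, h1, h2, h3⟩ := ih
        let π' : ℕ → x.W := fun n => Nat.casesOn n (x.σ 0) π
        have hf : IsFullpath x.M π' := by
          intro j
          cases j with
          | zero =>
            change x.M.rel (x.σ 0) (π 0)
            rw [h1 0 (by omega)]
            exact x.full 0
          | succ j => exact h j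
        refine ⟨i + 1, π', hf, ?_, h2, ?_⟩
        · intro j hj
          cases j with
          | zero => rfl
          | succ j => exact h1 j (by omega)
        · rw [S.ty_eq]
          have hl : S.lab ⟨x.W, x.M, π', hf⟩ = S.lab x :=
            S.lab_loc _ _ _ _ _ x.full rfl
          rw [hl]
          exact h3
    obtain ⟨i, π, h, h1, h2, h3⟩ := key
    exact ⟨i, π, h, h1, h2, (hF _).2 h3⟩

theorem sat_dfn (viol : V) (φ : Form V) : (fun x : Pt V => sat x.M viol φ x.σ) ∈ Dfn viol := by
  have hB := dfn_bool viol
  induction φ with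
  | atom p => exact dfn_sat viol (φ := .atom p) trivial
  | neg φ ih => exact hB.neg _ ih
  | conj φ ψ ih1 ih2 => exact hB.conj _ ih1 _ ih2
  | untl φ ψ ih1 ih2 =>
    obtain ⟨φ', h1, h2⟩ := ih1
    obtain ⟨ψ', h3, h4⟩ := ih2
    refine ⟨.untl φ' ψ', ⟨h1, h3⟩, fun x => ?_⟩
    refine exists_congr fun i => and_congr (h4 ⟨x.W, x.M, _, full_suffix x.full i⟩) ?_
    exact forall_congr' fun j => imp_congr_right fun _ => h2 ⟨x.W, x.M, _, full_suffix x.full j⟩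
  | next φ ih => exact dfn_next ih
  | fall φ ih =>
    refine BoolClosed.congr' (hB.neg _ (dfn_ex (hB.neg _ ih))) fun x => ?_
    simp only [sat]
    push Not
    rfl
  | oblig φ ih =>
    refine BoolClosed.congr' (hB.neg _ (dfn_ex (hB.conj _ (dfn_ff viol) _ (hB.neg _ ih))))
      fun x => ?_
    simp only [sat]
    push Not
    rfl
  | robust φ ih =>
    have hd : Dev viol (fun x => ¬ sat x.M viol φ x.σ) ∈ Dfn viol := by
      obtain ⟨ψ, h1, h2⟩ := ih
      obtain ⟨S, -, hS⟩ := exists_sys (viol := viol) (.neg ψ) h1 (Sys.triv viol)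
      have := dev_dfn S _ hS
      refine BoolClosed.congr' this fun x => ?_
      have h2' : (fun x : Pt V => ¬ sat x.M viol φ x.σ) =
          fun x : Pt V => sat x.M viol (.neg ψ) x.σ :=
        funext fun x => propext (not_congr (h2 x))
      rw [h2']
    refine BoolClosed.congr' (hB.conj _ ih _ (hB.neg _ hd)) fun x => ?_
    refine and_congr_right fun _ => ?_
    constructor
    · rintro h ⟨i, π, h1, h2, h3, h4⟩
      exact h4 (h π h1 ⟨i, h2, h3⟩)
    · rintro h π h1 ⟨i, h2, h3⟩
      by_contra h4
      exact h ⟨i, π, h1, h2, h3, h4⟩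

theorem exists_truth_preserving_translation_to_CTL {V : Type} (viol : V) :
    ∃ RC : Form V → Form V,
      (∀ φ : Form V, IsCTL (RC φ)) ∧
      ∀ (W : Type) (M : KStruct V W), IsRoCTL M viol →
        ∀ σ : ℕ → W, IsFullpath M σ → ∀ φ : Form V, ViolFree viol φ →
          (sat M viol φ σ ↔ sat M viol (RC φ) σ) := by
  choose RC h1 h2 using fun φ : Form V => sat_dfn viol φ
  exact ⟨RC, h1, fun W M _ σ hσ φ _ => h2 φ ⟨W, M, σ, hσ⟩⟩
end Stmt16
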